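/- Let R and S be reducibility candidates of λ-terms and let v be a λ-term such that for every u ∈ R the substituted term v[0 := u] belongs to S. Then for every u ∈ R, app (lam v) u ∈ S; that is, lam v belongs to the candidate R → S := { t | for every u ∈ R, app t u ∈ S }. -/

import Mathlib

/-- Untyped λ-terms with de Bruijn indices. -/
inductive Tm : Type
  | var : ℕ → Tm
  | app : Tm → Tm → Tm
  | lam : Tm → Tm
deriving DecidableEq

namespace Tm

/-- Lifting (shifting) of de Bruijn indices at cutoff `d`. -/
def lift (d : ℕ) : Tm → Tm
  | var n => if n < d then var n else var (n + 1)
  | app t u => app (lift d t) (lift d u)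
  | lam t => lam (lift (d + 1) t)

/-- Capture-avoiding substitution: `subst t k s` substitutes `s` for the
variable `k` in `t` (decrementing the free variables above `k`). -/
def subst : Tm → ℕ → Tm → Tm
  | var n, k, s => if n = k then s else if k < n then var (n - 1) else var n
  | app t u, k, s => app (subst t k s) (subst u k s)
  | lam t, k, s => lam (subst t (k + 1) (lift 0 s))

/-- One-step β-reduction: congruence closure of the root rule
`app (lam t) u → t[0 := u]`. -/
inductive Beta : Tm → Tm → Prop
  | beta (t u : Tm) : Beta (app (lam t) u) (subst t 0 u)
  | appL {t t' : Tm} (u : Tm) : Beta t t' → Beta (app t u) (app t' u)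
  | appR (t : Tm) {u u' : Tm} : Beta u u' → Beta (app t u) (app t u')
  | lam {t t' : Tm} : Beta t t' → Beta (lam t) (lam t')

/-- A term is strongly normalizing if it is accessible under β-reduction. -/
def SN (t : Tm) : Prop := Acc (fun a b => Beta b a) t

end Tm

open Tm

/-- A term is neutral iff it is not an abstraction. -/
def Neutral (t : Tm) : Prop := ∀ t₀ : Tm, t ≠ lam t₀

/-- A reducibility candidate: (R1) contained in SN, (R2) stable by reduction,
(R3) contains every neutral term all of whose one-step reducts it contains. -/
def IsCand (R : Set Tm) : Prop :=
  (∀ t ∈ R, SN t) ∧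
  (∀ t ∈ R, ∀ t', Beta t t' → t' ∈ R) ∧
  (∀ t, Neutral t → (∀ t', Beta t t' → t' ∈ R) → t ∈ R)

namespace Tm

theorem lift_lift (t : Tm) {i j : ℕ} (hij : i ≤ j) :
    lift i (lift j t) = lift (j + 1) (lift i t) := by
  induction t generalizing i j with
  | var n => grind [lift]
  | app t u iht ihu => simp only [lift, iht hij, ihu hij]
  | lam t ih => simp only [lift, ih (Nat.succ_le_succ hij)]

theorem subst_lift_self (t s : Tm) (k : ℕ) : subst (lift k t) k s = t := by
  induction t generalizing k s with
  | var n => grind [lift, subst]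
  | app t u iht ihu => simp only [lift, subst, iht, ihu]
  | lam t ih => simp only [lift, subst, ih]

theorem lift_subst (t s : Tm) {i j : ℕ} (hij : i ≤ j) :
    lift i (subst t j s) = subst (lift i t) (j + 1) (lift i s) := by
  induction t generalizing i j s with
  | var n => grind [lift, subst]
  | app t u iht ihu => simp only [lift, subst, iht _ hij, ihu _ hij]
  | lam t ih =>
    simp only [lift, subst, ih _ (Nat.succ_le_succ hij), lift_lift s (Nat.zero_le i)]

theorem subst_subst (t u s : Tm) {i j : ℕ} (hij : i ≤ j) :
    subst (subst t i u) j s = subst (subst t (j + 1) (lift i s)) i (subst u j s) := by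
  induction t generalizing i j u s with
  | var n => grind [subst, subst_lift_self]
  | app t t' iht iht' => simp only [subst, iht _ _ hij, iht' _ _ hij]
  | lam t ih =>
    simp only [subst, ih _ _ (Nat.succ_le_succ hij), lift_lift s (Nat.zero_le i),
      lift_subst u s (Nat.zero_le j)]

theorem Beta.subst {t t' : Tm} (h : Beta t t') (k : ℕ) (s : Tm) :
    Beta (Tm.subst t k s) (Tm.subst t' k s) := by
  induction h generalizing k s with
  | beta t u =>
    rw [subst_subst t u s (Nat.zero_le k)]
    exact Beta.beta _ _
  | appL u _ ih => exact Beta.appL _ (ih k s)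
  | appR t _ ih => exact Beta.appR _ (ih k s)
  | lam _ ih => exact Beta.lam (ih _ _)

theorem SN.of_subst {t : Tm} {k : ℕ} {s : Tm} (h : SN (subst t k s)) : SN t :=
  Subrelation.accessible (fun hab => Beta.subst hab k s)
    (InvImage.accessible (fun t => subst t k s) h)

end Tm

theorem IsCand.var_mem {R : Set Tm} (hR : IsCand R) (n : ℕ) : var n ∈ R :=
  hR.2.2 _ (fun _ => nofun) (fun _ => nofun)

/-- Computability of abstractions: if `v[0 := u] ∈ S` for every `u ∈ R`, then
`app (lam v) u ∈ S` for every `u ∈ R`, i.e. `lam v` is in the candidate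
`R → S`. -/
theorem lam_mem_arrow (R S : Set Tm) (hR : IsCand R) (hS : IsCand S) (v : Tm)
    (h : ∀ u ∈ R, subst v 0 u ∈ S) :
    ∀ u ∈ R, app (lam v) u ∈ S := by
  have hv : SN v := SN.of_subst (hS.1 _ (h _ (hR.var_mem 0)))
  induction hv with
  | intro v _ ihv =>
    intro u hu
    have hu_sn : SN u := hR.1 u hu
    induction hu_sn with
    | intro u _ ihu =>
      refine hS.2.2 _ (fun _ => nofun) fun t ht => ?_
      cases ht with
      | beta => exact h u hu
      | appL _ hlam =>
        cases hlam with
        | lam hv' =>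
          exact ihv _ hv' (fun w hw => hS.2.1 _ (h w hw) _ (hv'.subst 0 w)) u hu
      | appR _ hu' => exact ihu _ hu' (hR.2.1 u hu _ hu')
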